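/- Unbiasedness of the AIPW estimating function on RCT data: assume that, under ℙ₁ = ℙ(· ∣ R=1), A is conditionally independent of (Y(0), Y(1)) given σ(X), and that there is δ ∈ (0, 1/2) with δ ≤ e₁(X) ≤ 1 − δ ℙ₁-almost surely, where e₁(X) is a version of ℙ₁(A=1 ∣ σ(X)). Then 𝔼[ A(Y − μ₁(X))/e₁(X) − (1−A)(Y − μ₀(X))/(1 − e₁(X)) + μ₁(X) − μ₀(X) ∣ R=1 ] = 𝔼[Y(1) − Y(0) ∣ R=1], where μₐ(X) is any version of 𝔼[Y ∣ X, A=a] under ℙ₁ (a = 0, 1). -/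

import Mathlib

open MeasureTheory ProbabilityTheory

/-- Any conditional measure of a finite measure is a finite measure. -/
instance cond_isFiniteMeasure {Ω : Type*} [MeasurableSpace Ω] (μ : Measure Ω)
    [IsFiniteMeasure μ] (s : Set Ω) : IsFiniteMeasure (μ[|s]) := by
  constructor
  rw [ProbabilityTheory.cond, Measure.smul_apply, Measure.restrict_apply MeasurableSet.univ,
    Set.univ_inter, smul_eq_mul]
  exact lt_of_le_of_lt (ENNReal.inv_mul_le_one _) ENNReal.one_lt_top

/-- `v ∘ X` is a version of `𝔼_Q[W ∣ X]` on the event where the (real-valued) indicator `ind`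
equals one: for every bounded measurable `h : ℝ^p → ℝ`,
`𝔼_Q[ind · W · h(X)] = 𝔼_Q[ind · v(X) · h(X)]`.  Versions of conditional expectations
`𝔼_Q[Y ∣ X, A = a]` are obtained with `ind = 1{A=a}` and `W = Y`; versions of conditional
probabilities such as `Q(R=1 ∣ σ(X))` are obtained with `ind = 1` and `W = 1{R=1}`. -/
def IsCondVersion {Ω : Type*} [MeasurableSpace Ω] {p : ℕ} (Q : Measure Ω)
    (X : Ω → Fin p → ℝ) (ind : Ω → ℝ) (W : Ω → ℝ) (v : (Fin p → ℝ) → ℝ) : Prop :=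
  Measurable v ∧ ∀ h : (Fin p → ℝ) → ℝ, Measurable h → (∃ C, ∀ x, |h x| ≤ C) →
    ∫ ω, ind ω * W ω * h (X ω) ∂Q = ∫ ω, ind ω * v (X ω) * h (X ω) ∂Q

lemma int_of_version {Ω : Type*} [MeasurableSpace Ω] {p : ℕ} (Q : Measure Ω) [IsFiniteMeasure Q]
    (X : Ω → Fin p → ℝ) (hX : Measurable X) (B W : Ω → ℝ) (hB : Measurable B)
    (hB01 : ∀ ω, B ω = 0 ∨ B ω = 1) (v : (Fin p → ℝ) → ℝ)
    (hv : IsCondVersion Q X B W v) (hW : Integrable (fun ω => B ω * W ω) Q) :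
    Integrable (fun ω => B ω * v (X ω)) Q := by
  obtain ⟨hvm, hv⟩ := hv
  have hvX : Measurable fun ω => v (X ω) := hvm.comp hX
  let S : ℕ → Set (Fin p → ℝ) := fun n => {x | |v x| ≤ n}
  have hS : ∀ n, MeasurableSet (S n) := fun n => measurableSet_le hvm.abs measurable_const
  let h : ℕ → (Fin p → ℝ) → ℝ := fun n => (S n).indicator (fun x => if 0 ≤ v x then 1 else -1)
  have hh : ∀ n, Measurable (h n) := fun n =>
    (Measurable.ite (measurableSet_le measurable_const hvm) measurable_const
      measurable_const).indicator (hS n)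
  have hb : ∀ n x, |h n x| ≤ 1 := by
    intro n x
    simp only [h, Set.indicator]
    split_ifs <;> simp
  let G : ℕ → Ω → ℝ := fun n ω => B ω * v (X ω) * h n (X ω)
  have hGm : ∀ n, Measurable (G n) := fun n => (hB.mul hvX).mul ((hh n).comp hX)
  have hGnn : ∀ n ω, 0 ≤ G n ω ∧ G n ω ≤ n := by
    intro n ω
    simp only [G, h, Set.indicator, S, Set.mem_ofPred_eq]
    rcases hB01 ω with h0 | h0 <;> rw [h0] <;> split_ifs with h1 h2 <;>
      simp_all [abs_le] <;> constructor <;> linarith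
  have hGi : ∀ n, Integrable (G n) Q := fun n =>
    Integrable.of_bound (hGm n).aestronglyMeasurable (n : ℝ)
      (Filter.Eventually.of_forall fun ω => by
        rw [Real.norm_eq_abs, abs_of_nonneg (hGnn n ω).1]; exact (hGnn n ω).2)
  have hbound : ∀ n, ∫⁻ ω, ENNReal.ofReal (G n ω) ∂Q ≤ ENNReal.ofReal (∫ ω, |B ω * W ω| ∂Q) := by
    intro n
    rw [← ofReal_integral_eq_lintegral_ofReal (hGi n)
      (Filter.Eventually.of_forall fun ω => (hGnn n ω).1)]
    apply ENNReal.ofReal_le_ofReal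
    rw [← hv (h n) (hh n) ⟨1, hb n⟩]
    refine (le_abs_self _).trans ((abs_integral_le_integral_abs).trans ?_)
    refine integral_mono_of_nonneg (Filter.Eventually.of_forall fun ω => abs_nonneg _) hW.abs
      (Filter.Eventually.of_forall fun ω => ?_)
    simp only [abs_mul (B ω * W ω)]
    exact mul_le_of_le_one_right (abs_nonneg _) (hb n _)
  refine ⟨(hB.mul hvX).aestronglyMeasurable, ?_⟩
  rw [HasFiniteIntegral]
  have hlim : ∀ ω, ‖B ω * v (X ω)‖ₑ ≤
      Filter.liminf (fun n => ENNReal.ofReal (G n ω)) Filter.atTop := by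
    intro ω
    have : Filter.Tendsto (fun n => ENNReal.ofReal (G n ω)) Filter.atTop
        (nhds ‖B ω * v (X ω)‖ₑ) := by
      apply tendsto_const_nhds.congr'
      obtain ⟨N, hN⟩ := exists_nat_ge |v (X ω)|
      filter_upwards [Filter.eventually_ge_atTop N] with n hn
      have hmem : X ω ∈ S n := hN.trans (by exact_mod_cast hn)
      rw [← ofReal_norm, Real.norm_eq_abs]
      congr 1
      simp only [G, h, Set.indicator_of_mem hmem, abs_mul]
      rcases hB01 ω with h0 | h0 <;> rw [h0] <;> split_ifs with h1
      · simp
      · simp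
      · simp [abs_of_nonneg h1]
      · simp [abs_of_neg (not_le.1 h1)]
    exact this.liminf_eq.ge
  calc _ ≤ ∫⁻ ω, Filter.liminf (fun n => ENNReal.ofReal (G n ω)) Filter.atTop ∂Q :=
        lintegral_mono hlim
    _ ≤ Filter.liminf (fun n => ∫⁻ ω, ENNReal.ofReal (G n ω) ∂Q) Filter.atTop :=
        lintegral_liminf_le fun n => (hGm n).ennreal_ofReal
    _ ≤ ENNReal.ofReal (∫ ω, |B ω * W ω| ∂Q) := by
        refine Filter.liminf_le_of_le (by isBoundedDefault) fun b hb' => ?_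
        obtain ⟨n, hn⟩ := hb'.exists
        exact hn.trans (hbound n)
    _ < ⊤ := ENNReal.ofReal_lt_top

/-- One-arm statement. -/
lemma arm {Ω : Type*} (m : MeasurableSpace Ω) [mΩ : MeasurableSpace Ω] [StandardBorelSpace Ω] {p : ℕ}
    (Q : Measure Ω) [IsFiniteMeasure Q]
    (X : Ω → Fin p → ℝ) (hX : Measurable X) (B W Y : Ω → ℝ) (hB : Measurable B)
    (hB01 : ∀ ω, B ω = 0 ∨ B ω = 1) (hWm : Measurable W) (hW : Integrable W Q)
    (hYW : ∀ ω, B ω * Y ω = B ω * W ω)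
    (hmle : m ≤ mΩ) (hXm : Measurable[m] X)
    (hCI : CondIndepFun m hmle B W Q)
    (δ : ℝ) (hδ : 0 < δ) (e : (Fin p → ℝ) → ℝ) (hem : Measurable e)
    (hec : (fun ω => e (X ω)) =ᵐ[Q] Q[B | m])
    (hbd : ∀ᵐ ω ∂Q, δ ≤ e (X ω)) (v : (Fin p → ℝ) → ℝ) (hv : IsCondVersion Q X B Y v) :
    Integrable (fun ω => v (X ω)) Q ∧
    Integrable (fun ω => B ω * (Y ω - v (X ω)) / e (X ω)) Q ∧
    ∫ ω, B ω * (Y ω - v (X ω)) / e (X ω) ∂Q = 0 ∧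
    ∫ ω, v (X ω) ∂Q = ∫ ω, W ω ∂Q := by
  have hBb : ∀ ω, ‖B ω‖ ≤ 1 := by
    intro ω; rcases hB01 ω with h | h <;> simp [h]
  have hBi : Integrable B Q := Integrable.of_bound hB.aestronglyMeasurable 1
    (Filter.Eventually.of_forall hBb)
  have hBW : Integrable (fun ω => B ω * W ω) Q :=
    hW.bdd_mul hB.aestronglyMeasurable (Filter.Eventually.of_forall hBb)
  have hBY : Integrable (fun ω => B ω * Y ω) Q := by simpa only [hYW] using hBW
  have hBv := int_of_version Q X hX B Y hB hB01 v hv hBY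
  -- the bounded inverse
  let h : (Fin p → ℝ) → ℝ := fun x => (max (e x) δ)⁻¹
  have hhm : Measurable h := (hem.max measurable_const).inv
  have hh0 : ∀ x, 0 ≤ h x := fun x => inv_nonneg.2 (hδ.le.trans (le_max_right _ _))
  have hhb : ∀ x, |h x| ≤ δ⁻¹ := fun x => by
    rw [abs_of_nonneg (hh0 x)]
    exact inv_anti₀ hδ (le_max_right _ _)
  have hhe : ∀ᵐ ω ∂Q, h (X ω) = (e (X ω))⁻¹ ∧ e (X ω) ≠ 0 := by
    filter_upwards [hbd] with ω hω
    exact ⟨by simp only [h, max_eq_left hω], (hδ.trans_le hω).ne'⟩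
  have hhX : AEStronglyMeasurable (fun ω => h (X ω)) Q := (hhm.comp hX).aestronglyMeasurable
  have hmulh : ∀ f : Ω → ℝ, Integrable f Q → Integrable (fun ω => f ω * h (X ω)) Q :=
    fun f hf => hf.mul_bdd hhX (Filter.Eventually.of_forall fun ω => hhb (X ω))
  -- pull-out
  have pull : ∀ g : Ω → ℝ, StronglyMeasurable[m] g → Integrable (B * g) Q →
      Integrable (fun ω => e (X ω) * g ω) Q ∧ ∫ ω, B ω * g ω ∂Q = ∫ ω, e (X ω) * g ω ∂Q := by
    intro g hg hgi
    have h1 := condExp_mul_of_stronglyMeasurable_right hg hgi hBi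
    have h2 : Q[B * g | m] =ᵐ[Q] fun ω => e (X ω) * g ω := by
      filter_upwards [h1, hec] with ω h1 h2
      rw [h1, Pi.mul_apply, h2]
    refine ⟨integrable_condExp.congr h2, ?_⟩
    rw [← integral_congr_ae h2, integral_condExp hmle]
    rfl
  have hvm : Measurable v := hv.1
  have hgm : StronglyMeasurable[m] fun ω => v (X ω) * h (X ω) :=
    ((hvm.mul hhm).comp hXm).stronglyMeasurable
  have hBvh := hmulh _ hBv
  have hBYh := hmulh _ hBY
  obtain ⟨i1, i2⟩ := pull _ hgm (hBvh.congr (Filter.Eventually.of_forall fun ω => by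
    simp only [Pi.mul_apply]; ring))
  have hev : (fun ω => e (X ω) * (v (X ω) * h (X ω))) =ᵐ[Q] fun ω => v (X ω) := by
    filter_upwards [hhe] with ω hω
    rw [hω.1]; field_simp [hω.2]
  have hvh := hv.2 h hhm ⟨_, hhb⟩
  have hres : (fun ω => B ω * (Y ω - v (X ω)) / e (X ω)) =ᵐ[Q]
      fun ω => B ω * Y ω * h (X ω) - B ω * v (X ω) * h (X ω) := by
    filter_upwards [hhe] with ω hω
    rw [hω.1]; ring
  -- change of measure
  have key : ∫ ω, B ω * W ω * h (X ω) ∂Q = ∫ ω, W ω ∂Q := by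
    let d : Ω → NNReal := fun ω => Real.toNNReal (B ω * h (X ω))
    have hB0 : ∀ ω, 0 ≤ B ω := by
      intro ω; rcases hB01 ω with h | h <;> simp [h]
    have hd0 : ∀ ω, 0 ≤ B ω * h (X ω) := fun ω => mul_nonneg (hB0 ω) (hh0 _)
    have hdm : Measurable d := (hB.mul (hhm.comp hX)).real_toNNReal
    have hmap : (Q.withDensity (fun ω => (d ω : ENNReal))).map W = Q.map W := by
      ext s hs
      rw [Measure.map_apply hWm hs, Measure.map_apply hWm hs, withDensity_apply _ (hWm hs)]
      have hci := (condIndepFun_iff_condExp_inter_preimage_eq_mul hB hWm).1 hCI {1} s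
        (measurableSet_singleton _) hs
      set T := W ⁻¹' s with hT
      have hTm : MeasurableSet T := hWm hs
      have hBind : (B ⁻¹' {1}).indicator (fun _ => (1:ℝ)) = B := by
        ext ω
        rcases hB01 ω with h | h <;> simp [Set.indicator, h]
      have hBT : (B ⁻¹' {1} ∩ T).indicator (fun _ => (1:ℝ)) =
          fun ω => T.indicator (fun _ => (1:ℝ)) ω * B ω := by
        ext ω
        have hmem : ω ∈ B ⁻¹' {1} ↔ B ω = 1 := Iff.rfl
        by_cases hω : ω ∈ T <;> rcases hB01 ω with h | h <;>
          simp [Set.indicator, Set.mem_inter_iff, hmem, h, hω]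
      rw [hBind, hBT] at hci
      have hTi : Integrable (T.indicator (fun _ => (1:ℝ))) Q :=
        (integrable_const _).indicator hTm
      have hTBi : Integrable (fun ω => T.indicator (fun _ => (1:ℝ)) ω * B ω) Q :=
        hTi.mul_bdd hB.aestronglyMeasurable (Filter.Eventually.of_forall hBb)
      have hhXm : StronglyMeasurable[m] fun ω => h (X ω) := (hhm.comp hXm).stronglyMeasurable
      have h1 := condExp_mul_of_stronglyMeasurable_right hhXm (hmulh _ hTBi) hTBi
      have h2 : Q[(fun ω => T.indicator (fun _ => (1:ℝ)) ω * B ω) * (fun ω => h (X ω)) | m]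
          =ᵐ[Q] Q[T.indicator (fun _ => (1:ℝ)) | m] := by
        filter_upwards [h1, hci, hec, hhe] with ω h1 h2 h3 h4
        rw [h1, Pi.mul_apply, h2, ← h3, h4.1]
        have := h4.2
        field_simp
      have h3 := integral_congr_ae h2
      rw [integral_condExp hmle, integral_condExp hmle, integral_indicator hTm] at h3
      have h4 : ∫⁻ ω in T, (d ω : ENNReal) ∂Q = ∫⁻ ω, ENNReal.ofReal
          (T.indicator (fun _ => (1:ℝ)) ω * B ω * h (X ω)) ∂Q := by
        rw [← lintegral_indicator hTm]
        congr 1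
        ext ω
        by_cases hω : ω ∈ T <;> simp [hω, d, ENNReal.ofReal]
      rw [h4, ← ofReal_integral_eq_lintegral_ofReal (hmulh _ hTBi)]
      · have h5 : ∫ ω, T.indicator (fun _ => (1:ℝ)) ω * B ω * h (X ω) ∂Q = Q.real T := by
          simpa using h3
        rw [h5, Measure.real, ENNReal.ofReal_toReal (measure_ne_top _ _)]
      · refine Filter.Eventually.of_forall fun ω => ?_
        simp only [Pi.zero_apply, mul_assoc]
        exact mul_nonneg (Set.indicator_nonneg (fun _ _ => zero_le_one) _) (hd0 ω)
    have e1 : ∫ ω, W ω ∂(Q.withDensity (fun ω => (d ω : ENNReal))) = ∫ ω, W ω ∂Q := by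
      have a1 := integral_map (μ := Q) hWm.aemeasurable (f := fun x : ℝ => x)
        measurable_id.aestronglyMeasurable
      have a2 := integral_map (μ := Q.withDensity (fun ω => (d ω : ENNReal))) hWm.aemeasurable
        (f := fun x : ℝ => x) measurable_id.aestronglyMeasurable
      rw [← a1, ← a2, hmap]
    rw [← e1, integral_withDensity_eq_integral_smul hdm]
    congr 1
    ext ω
    rw [NNReal.smul_def, smul_eq_mul, Real.coe_toNNReal _ (hd0 ω)]
    ring
  refine ⟨i1.congr hev, (hBYh.sub hBvh).congr hres.symm, ?_, ?_⟩
  · rw [integral_congr_ae hres, integral_sub hBYh hBvh, hvh, sub_self]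
  · rw [← integral_congr_ae hev, ← i2, ← key]
    simp only [← hYW]
    rw [hvh]
    congr 1
    ext ω
    ring

lemma aux_cond {Ω : Type*} [mΩ : MeasurableSpace Ω] {p : ℕ}
    (Q : Measure Ω) [IsFiniteMeasure Q]
    (X : Ω → Fin p → ℝ) (hX : Measurable X) (B : Ω → ℝ) (hBi : Integrable B Q)
    (e : (Fin p → ℝ) → ℝ) (he : IsCondVersion Q X (fun _ => 1) B e)
    (hbd : ∀ᵐ ω ∂Q, 0 ≤ e (X ω) ∧ e (X ω) ≤ 1) :
    (fun ω => e (X ω)) =ᵐ[Q] Q[B | MeasurableSpace.comap X inferInstance] := by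
  have hei : Integrable (fun ω => e (X ω)) Q :=
    Integrable.of_bound (he.1.comp hX).aestronglyMeasurable 1 (by
      filter_upwards [hbd] with ω hω
      rw [Real.norm_eq_abs, abs_of_nonneg hω.1]; exact hω.2)
  refine ae_eq_condExp_of_forall_setIntegral_eq hX.comap_le hBi (fun s _ _ => hei.integrableOn)
    ?_ (he.1.comp (comap_measurable X)).stronglyMeasurable.aestronglyMeasurable
  rintro s ⟨t, ht, rfl⟩ -
  have := he.2 (t.indicator fun _ => 1) (measurable_const.indicator ht)
    ⟨1, fun x => by simp only [Set.indicator]; split_ifs <;> simp⟩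
  rw [← integral_indicator (hX ht), ← integral_indicator (hX ht)]
  have conv : ∀ f : Ω → ℝ, (X ⁻¹' t).indicator f =
      fun ω => 1 * f ω * t.indicator (fun _ => 1) (X ω) := by
    intro f; ext ω
    by_cases hω : X ω ∈ t <;> simp [Set.indicator, hω]
  rw [conv, conv]
  exact this.symm

/-- Unbiasedness of the AIPW estimating function on the RCT data. -/
theorem aipw_unbiased {Ω : Type*} [MeasurableSpace Ω] [StandardBorelSpace Ω] [Nonempty Ω]
    (P : Measure Ω) [IsProbabilityMeasure P]
    (p : ℕ) (hp : 1 ≤ p)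
    (X : Ω → Fin p → ℝ) (hX : Measurable X)
    (A R : Ω → ℝ) (hA : Measurable A) (hR : Measurable R)
    (hA01 : ∀ ω, A ω = 0 ∨ A ω = 1) (hR01 : ∀ ω, R ω = 0 ∨ R ω = 1)
    (Y0 Y1 : Ω → ℝ) (hY0m : Measurable Y0) (hY1m : Measurable Y1)
    (hY0 : Integrable Y0 P) (hY1 : Integrable Y1 P)
    (Y : Ω → ℝ) (hY : ∀ ω, Y ω = A ω * Y1 ω + (1 - A ω) * Y0 ω)
    (q : ℝ) (hq : P {ω | R ω = 1} = ENNReal.ofReal q) (hq0 : 0 < q) (hq1 : q < 1)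
    -- strong ignorability: A ⫫ (Y(0), Y(1)) ∣ σ(X) under P₁ = P(⬝ ∣ R = 1)
    (hCI : CondIndepFun (MeasurableSpace.comap X inferInstance) hX.comap_le
      A (fun ω => (Y0 ω, Y1 ω)) (P[|{ω | R ω = 1}]))
    -- propensity score bounded away from 0 and 1 by δ
    (δ : ℝ) (hδ : δ ∈ Set.Ioo (0 : ℝ) (1 / 2))
    (e₁ : (Fin p → ℝ) → ℝ)
    (he₁ : IsCondVersion (P[|{ω | R ω = 1}]) X (fun _ => 1) A e₁)
    (he₁bd : ∀ᵐ ω ∂(P[|{ω | R ω = 1}]), δ ≤ e₁ (X ω) ∧ e₁ (X ω) ≤ 1 - δ)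
    -- outcome regression functions in the RCT
    (μ₀ μ₁ : (Fin p → ℝ) → ℝ)
    (hμ₀ : IsCondVersion (P[|{ω | R ω = 1}]) X (fun ω => 1 - A ω) Y μ₀)
    (hμ₁ : IsCondVersion (P[|{ω | R ω = 1}]) X A Y μ₁) :
    ∫ ω, (A ω * (Y ω - μ₁ (X ω)) / e₁ (X ω)
          - (1 - A ω) * (Y ω - μ₀ (X ω)) / (1 - e₁ (X ω))
          + (μ₁ (X ω) - μ₀ (X ω))) ∂(P[|{ω | R ω = 1}]) =
      ∫ ω, (Y1 ω - Y0 ω) ∂(P[|{ω | R ω = 1}]) := by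
  set Q := P[|{ω | R ω = 1}] with hQ
  have hδ0 : 0 < δ := hδ.1
  have hPne : P {ω | R ω = 1} ≠ 0 := by
    rw [hq]; simpa using hq0
  have hQs : Q = (P {ω | R ω = 1})⁻¹ • P.restrict {ω | R ω = 1} := rfl
  have hint : ∀ f : Ω → ℝ, Integrable f P → Integrable f Q := fun f hf => by
    rw [hQs]
    exact (hf.mono_measure Measure.restrict_le_self).smul_measure (ENNReal.inv_ne_top.2 hPne)
  have hAi : Integrable A Q := Integrable.of_bound hA.aestronglyMeasurable 1
    (Filter.Eventually.of_forall fun ω => by rcases hA01 ω with h | h <;> simp [h])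
  have hec := aux_cond Q X hX A hAi e₁ he₁ (by
    filter_upwards [he₁bd] with ω hω
    constructor <;> linarith [hω.1, hω.2])
  have hec0 : (fun ω => (fun x => 1 - e₁ x) (X ω)) =ᵐ[Q]
      Q[fun ω => 1 - A ω | MeasurableSpace.comap X inferInstance] := by
    have h1 := condExp_sub (μ := Q) (integrable_const (1:ℝ)) hAi
      (MeasurableSpace.comap X inferInstance)
    have h2 := condExp_const (μ := Q) hX.comap_le (1:ℝ)
    filter_upwards [h1, hec] with ω h1 h3
    refine Eq.trans ?_ h1.symm
    simp only [Pi.sub_apply, h2, ← h3]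
  obtain ⟨a1, a2, a3, a4⟩ := arm (MeasurableSpace.comap X inferInstance) Q X hX A Y1 Y hA hA01 hY1m (hint _ hY1)
    (fun ω => by rw [hY]; rcases hA01 ω with h | h <;> simp [h])
    hX.comap_le (comap_measurable X) (hCI.comp measurable_id measurable_snd) δ hδ0 e₁ he₁.1 hec
    (he₁bd.mono fun _ h => h.1) μ₁ hμ₁
  obtain ⟨b1, b2, b3, b4⟩ := arm (MeasurableSpace.comap X inferInstance) Q X hX (fun ω => 1 - A ω) Y0 Y (measurable_const.sub hA)
    (fun ω => by rcases hA01 ω with h | h <;> simp [h]) hY0m (hint _ hY0)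
    (fun ω => by rw [hY]; rcases hA01 ω with h | h <;> simp [h])
    hX.comap_le (comap_measurable X) (hCI.comp (φ := fun x : ℝ => 1 - x) (measurable_const.sub measurable_id) measurable_fst)
    δ hδ0 (fun x => 1 - e₁ x)
    (measurable_const.sub he₁.1) hec0
    (he₁bd.mono fun _ h => by linarith [h.2]) μ₀ hμ₀
  refine (integral_add (a2.sub b2) (a1.sub b1)).trans ?_
  simp only [Pi.sub_apply]
  rw [integral_sub a2 b2, integral_sub a1 b1,
    integral_sub (hint _ hY1) (hint _ hY0), a3, b3, a4, b4]
  ring
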